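/- arXiv:2106.03539 — 2 statements merged into one kernel-verified Lean document; each statement's English description precedes it below -/
import Mathlib

section
/- Each matrix of the universal Clifford+T gate set is the rate matrix of a Quantum Petri net: there exist rate functions on the 2-qubit net (for CNOT) and on the 1-qubit net (for H, S, T) whose rate matrices, with rows and columns indexed by the reachability set identified with bit strings in the order 00, 01, 10, 11 (respectively 0, 1), equal CNOT = [[1,0,0,0],[0,1,0,0],[0,0,0,1],[0,0,1,0]], H = (1/√2)·[[1,1],[1,−1]], S = [[1,0],[0,i]], and T = [[1,0],[0,e^{iπ/4}]]. -/
/-- A Place-Transition net: flow functions giving each transition its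
input and output multiset of places. -/
structure PTN (P T : Type) where
  Fminus : T → Multiset P
  Fplus : T → Multiset P

namespace PTN

variable {P T : Type} [DecidableEq P]

/-- Input flow of a concurrence (multiset of transitions), extended additively. -/
def inFlow (N : PTN P T) (t : Multiset T) : Multiset P := (t.map N.Fminus).sum

/-- Output flow of a concurrence, extended additively. -/
def outFlow (N : PTN P T) (t : Multiset T) : Multiset P := (t.map N.Fplus).sum

/-- `N.Fires m t m'` : concurrence `t` is enabled at marking `m` and firing it yields `m'`. -/
def Fires (N : PTN P T) (m : Multiset P) (t : Multiset T) (m' : Multiset P) : Prop :=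
  N.inFlow t ≤ m ∧ m' = m - N.inFlow t + N.outFlow t

/-- Direct single-transition reachability: firing some concurrence of cardinality 1. -/
def Step1 (N : PTN P T) (m m' : Multiset P) : Prop :=
  ∃ t : Multiset T, Multiset.card t = 1 ∧ N.Fires m t m'

/-- Reachability set of the system net `(N, M0)`. -/
def ReachSet (N : PTN P T) (M0 : Multiset P) : Set (Multiset P) :=
  {m | Relation.ReflTransGen N.Step1 M0 m}

/-- Entry `R_Q[m', m]` of the rate matrix: sum of `r m t` over all concurrences `t`
with `m →_t m'`. -/
noncomputable def rateEntry (N : PTN P T) (r : Multiset P → Multiset T → ℂ)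
    (m m' : Multiset P) : ℂ :=
  ∑ᶠ t ∈ {t : Multiset T | N.Fires m t m'}, r m t

end PTN

/-- The `n`-qubit net: places `(i, b)` for `i < n`, `b : Bool`; the transition `(i, b)`
moves the token of qubit `i` from `(i, b)` to `(i, !b)` (so `(i, false)` is `u_i` and
`(i, true)` is `d_i`). -/
def qubitNet (n : ℕ) : PTN (Fin n × Bool) (Fin n × Bool) where
  Fminus := fun t => {t}
  Fplus := fun t => {(t.1, !t.2)}

/-- The safe marking corresponding to the bit string `b : Fin n → Bool`. -/
def safeMarking {n : ℕ} (b : Fin n → Bool) : Multiset (Fin n × Bool) :=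
  Finset.univ.val.map fun i => (i, b i)

/-- The CNOT matrix `[[1,0,0,0],[0,1,0,0],[0,0,0,1],[0,0,1,0]]`, with rows and columns
indexed by bit strings of length 2 in the order 00, 01, 10, 11 (bit 0 is the control,
bit 1 the target): it sends `|x y⟩` to `|x (y XOR x)⟩`. -/
def CNOTmat : Matrix (Fin 2 → Bool) (Fin 2 → Bool) ℂ :=
  fun b' b => if b' 0 = b 0 ∧ b' 1 = xor (b 1) (b 0) then 1 else 0

/-- The Hadamard matrix `(1/√2)·[[1,1],[1,−1]]`, indexed by bits in the order 0, 1. -/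
noncomputable def Hmat : Matrix Bool Bool ℂ :=
  fun b' b => (Real.sqrt 2 : ℂ)⁻¹ * (if b' = true ∧ b = true then -1 else 1)

/-- The S matrix `[[1,0],[0,i]]`. -/
def Smat : Matrix Bool Bool ℂ :=
  fun b' b => if b' = b then (if b = true then Complex.I else 1) else 0

/-- The T matrix `[[1,0],[0,e^{iπ/4}]]`. -/
noncomputable def Tmat : Matrix Bool Bool ℂ :=
  fun b' b => if b' = b then (if b = true then Complex.exp (Complex.I * Real.pi / 4) else 1)
    else 0

/-- The multiplicity of the place `(i, c)` in a safe marking. -/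
theorem count_safeMarking {n : ℕ} (b : Fin n → Bool) (i : Fin n) (c : Bool) :
    (safeMarking b).count (i, c) = if c = b i then 1 else 0 := by
  have hnd : (safeMarking b).Nodup :=
    Finset.univ.nodup.map fun i j h => congrArg Prod.fst h
  rw [Multiset.count_eq_of_nodup hnd]
  simp [safeMarking, eq_comm]

theorem qubitNet_inFlow {n : ℕ} (t : Multiset (Fin n × Bool)) :
    (qubitNet n).inFlow t = t := by
  simp [PTN.inFlow, qubitNet, Multiset.sum_map_singleton]

theorem count_qubitNet_outFlow {n : ℕ} (t : Multiset (Fin n × Bool)) (i : Fin n) (c : Bool) :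
    ((qubitNet n).outFlow t).count (i, c) = t.count (i, !c) := by
  have hmap : (qubitNet n).outFlow t = t.map fun p => (p.1, !p.2) := by
    induction t using Multiset.induction_on with
    | empty => simp [PTN.outFlow]
    | cons a t ih =>
      simp only [PTN.outFlow, qubitNet, Multiset.map_cons, Multiset.sum_cons] at ih ⊢
      rw [ih, Multiset.singleton_add]
  have hinj : Function.Injective fun p : Fin n × Bool => (p.1, !p.2) := by
    rintro ⟨i, c⟩ ⟨j, d⟩ h
    simpa using h
  simpa [hmap] using Multiset.count_map_eq_count' _ t hinj (i, !c)

/-- Between two safe markings there is exactly one concurrence: it moves the tokens of the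
qubits at which the two bit strings differ. -/
theorem qubitNet_fires_safeMarking_iff {n : ℕ} (b b' : Fin n → Bool)
    (t : Multiset (Fin n × Bool)) :
    (qubitNet n).Fires (safeMarking b) t (safeMarking b') ↔
      t = safeMarking b - safeMarking b' := by
  simp only [PTN.Fires, qubitNet_inFlow, Multiset.le_iff_count, Multiset.ext, Prod.forall,
    Multiset.count_add, Multiset.count_sub, count_qubitNet_outFlow, count_safeMarking,
    ← forall_and]
  refine forall_congr' fun i => ?_
  simp only [Bool.forall_bool]
  cases b i <;> cases b' i <;> simp [-Multiset.count_eq_zero] <;> omega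

/-- The bit string read off from a marking. -/
def markingBits {n : ℕ} (m : Multiset (Fin n × Bool)) (i : Fin n) : Bool :=
  decide ((i, true) ∈ m)

theorem markingBits_safeMarking {n : ℕ} (b : Fin n → Bool) :
    markingBits (safeMarking b) = b := by
  funext i
  cases h : b i <;> simp [markingBits, safeMarking, h]

/-- Every complex matrix indexed by bit strings of length `n` is the rate matrix of a QPN over
the `n`-qubit net. -/
theorem exists_rateEntry_qubitNet_eq {n : ℕ} (U : Matrix (Fin n → Bool) (Fin n → Bool) ℂ) :
    ∃ r : Multiset (Fin n × Bool) → Multiset (Fin n × Bool) → ℂ,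
      ∀ b b' : Fin n → Bool,
        (qubitNet n).rateEntry r (safeMarking b) (safeMarking b') = U b' b := by
  refine ⟨fun m t => U (markingBits (m - t + (qubitNet n).outFlow t)) (markingBits m),
    fun b b' => ?_⟩
  have hfires := (qubitNet_fires_safeMarking_iff b b' _).2 rfl
  have hset : {t | (qubitNet n).Fires (safeMarking b) t (safeMarking b')} =
      {safeMarking b - safeMarking b'} :=
    Set.ext fun t => qubitNet_fires_safeMarking_iff b b' t
  have htarget := hfires.2
  rw [qubitNet_inFlow] at htarget
  rw [PTN.rateEntry, hset, finsum_mem_singleton, ← htarget, markingBits_safeMarking,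
    markingBits_safeMarking]

/-- **Clifford+T QPNs.** Each matrix of the universal Clifford+T gate set is the rate
matrix of a QPN: there are rate functions on the 2-qubit net (for CNOT) and on the
1-qubit net (for H, S, T) whose rate matrices, with rows and columns indexed by the
reachability set identified with bit strings via `safeMarking`, equal CNOT, H, S, T. -/
theorem cliffordT_qpns :
    (∃ r : Multiset (Fin 2 × Bool) → Multiset (Fin 2 × Bool) → ℂ,
      ∀ b b' : Fin 2 → Bool,
        (qubitNet 2).rateEntry r (safeMarking b) (safeMarking b') = CNOTmat b' b) ∧
    (∃ r : Multiset (Fin 1 × Bool) → Multiset (Fin 1 × Bool) → ℂ,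
      ∀ b b' : Fin 1 → Bool,
        (qubitNet 1).rateEntry r (safeMarking b) (safeMarking b') = Hmat (b' 0) (b 0)) ∧
    (∃ r : Multiset (Fin 1 × Bool) → Multiset (Fin 1 × Bool) → ℂ,
      ∀ b b' : Fin 1 → Bool,
        (qubitNet 1).rateEntry r (safeMarking b) (safeMarking b') = Smat (b' 0) (b 0)) ∧
    (∃ r : Multiset (Fin 1 × Bool) → Multiset (Fin 1 × Bool) → ℂ,
      ∀ b b' : Fin 1 → Bool,
        (qubitNet 1).rateEntry r (safeMarking b) (safeMarking b') = Tmat (b' 0) (b 0)) := by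
  exact ⟨exists_rateEntry_qubitNet_eq CNOTmat,
    exists_rateEntry_qubitNet_eq fun b' b => Hmat (b' 0) (b 0),
    exists_rateEntry_qubitNet_eq fun b' b => Smat (b' 0) (b 0),
    exists_rateEntry_qubitNet_eq fun b' b => Tmat (b' 0) (b 0)⟩
end

section
/- Kronecker sum of QPNs: let Q = (S, r) and Q' = (S', r') be Quantum Petri nets with reachability sets R₀ and R₀'. On the juxtaposition with initial marking M₀·M₀', define the rate function r'' by r''_{m·m'}(t·1) = r_m(t) for nonempty t over T, r''_{m·m'}(1·t') = r'_{m'}(t') for nonempty t' over T', r''_{m·m'}(1) = r_m(1) + r'_{m'}(1) for the empty concurrence, and r''_{m·m'}(t·t') = 0 when both t and t' are nonempty. Then, identifying the reachability set of the juxtaposition with R₀ × R₀', the resulting rate matrix equals the Kronecker sum R_Q ⊗ I + I ⊗ R_{Q'} of the component rate matrices (I denoting identity matrices of the appropriate sizes). -/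
/-- Juxtaposition (disjoint parallel composition) of two PTNs. -/
def PTN.juxta {P T P' T' : Type} (N : PTN P T) (N' : PTN P' T') : PTN (P ⊕ P') (T ⊕ T') where
  Fminus := Sum.elim (fun t => (N.Fminus t).map Sum.inl) (fun t => (N'.Fminus t).map Sum.inr)
  Fplus := Sum.elim (fun t => (N.Fplus t).map Sum.inl) (fun t => (N'.Fplus t).map Sum.inr)

/-- The product `s·s'` of a multiset over `α` with a multiset over `β`, as a multiset
over `α ⊕ β`; used for markings and concurrences of a juxtaposition. -/
def mprod {α β : Type} (s : Multiset α) (s' : Multiset β) : Multiset (α ⊕ β) :=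
  s.map Sum.inl + s'.map Sum.inr

theorem count_inl_mprod {α β : Type} [DecidableEq α] [DecidableEq β] (s : Multiset α)
    (s' : Multiset β) (a : α) : (mprod s s').count (Sum.inl a) = s.count a := by
  rw [mprod, Multiset.count_add, Multiset.count_map_eq_count' _ _ Sum.inl_injective,
    Multiset.count_eq_zero_of_notMem (s := s'.map Sum.inr) (by simp), add_zero]

theorem count_inr_mprod {α β : Type} [DecidableEq α] [DecidableEq β] (s : Multiset α)
    (s' : Multiset β) (b : β) : (mprod s s').count (Sum.inr b) = s'.count b := by
  rw [mprod, Multiset.count_add, Multiset.count_map_eq_count' _ _ Sum.inr_injective,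
    Multiset.count_eq_zero_of_notMem (s := s.map Sum.inl) (by simp), zero_add]

theorem mprod_le_mprod {α β : Type} {s t : Multiset α} {s' t' : Multiset β} :
    mprod s s' ≤ mprod t t' ↔ s ≤ t ∧ s' ≤ t' := by
  classical
  simp only [Multiset.le_iff_count, Sum.forall, count_inl_mprod, count_inr_mprod]

theorem mprod_inj {α β : Type} {s t : Multiset α} {s' t' : Multiset β} :
    mprod s s' = mprod t t' ↔ s = t ∧ s' = t' := by
  classical
  simp only [Multiset.ext, Sum.forall, count_inl_mprod, count_inr_mprod]

theorem mprod_add_mprod {α β : Type} (s t : Multiset α) (s' t' : Multiset β) :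
    mprod s s' + mprod t t' = mprod (s + t) (s' + t') := by
  simp only [mprod, Multiset.map_add]
  abel

theorem mprod_sub_mprod {α β : Type} [DecidableEq α] [DecidableEq β] (s t : Multiset α)
    (s' t' : Multiset β) : mprod s s' - mprod t t' = mprod (s - t) (s' - t') := by
  simp only [Multiset.ext, Sum.forall, Multiset.count_sub, count_inl_mprod, count_inr_mprod,
    implies_true, and_self]

theorem exists_eq_mprod {α β : Type} (u : Multiset (α ⊕ β)) :
    ∃ (s : Multiset α) (s' : Multiset β), mprod s s' = u := by
  induction u using Multiset.induction with
  | empty => exact ⟨0, 0, rfl⟩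
  | cons x u ih =>
    obtain ⟨s, s', rfl⟩ := ih
    cases x with
    | inl a => exact ⟨a ::ₘ s, s', by simp [mprod]⟩
    | inr b => exact ⟨s, b ::ₘ s', by simp [mprod]⟩

/-- Additive extensions of a componentwise flow split along the product of concurrences. -/
theorem sum_map_elim_mprod {P T P' T' : Type} (f : T → Multiset P) (f' : T' → Multiset P')
    (t : Multiset T) (t' : Multiset T') :
    ((mprod t t').map (Sum.elim (fun x => (f x).map Sum.inl)
      (fun x => (f' x).map Sum.inr))).sum = mprod (t.map f).sum (t'.map f').sum := by
  have h {α β γ : Type} (g : α → Multiset β) (i : β → γ) (s : Multiset α) :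
      (s.map fun x => (g x).map i).sum = (s.map g).sum.map i := by
    induction s using Multiset.induction with
    | empty => simp
    | cons a s ih => simp [ih]
  simp [mprod, Multiset.map_map, Function.comp_def, h]

theorem juxta_fires_mprod {P T P' T' : Type} [DecidableEq P] [DecidableEq P']
    (N : PTN P T) (N' : PTN P' T') (m₁ m₂ : Multiset P) (m₁' m₂' : Multiset P')
    (t : Multiset T) (t' : Multiset T') :
    (N.juxta N').Fires (mprod m₁ m₁') (mprod t t') (mprod m₂ m₂') ↔
      N.Fires m₁ t m₂ ∧ N'.Fires m₁' t' m₂' := by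
  have hin : (N.juxta N').inFlow (mprod t t') = mprod (N.inFlow t) (N'.inFlow t') :=
    sum_map_elim_mprod ..
  have hout : (N.juxta N').outFlow (mprod t t') = mprod (N.outFlow t) (N'.outFlow t') :=
    sum_map_elim_mprod ..
  simp only [PTN.Fires, hin, hout, mprod_le_mprod, mprod_sub_mprod, mprod_add_mprod, mprod_inj]
  tauto

theorem fires_zero {P T : Type} [DecidableEq P] (N : PTN P T) (m m' : Multiset P) :
    N.Fires m 0 m' ↔ m' = m := by
  simp [PTN.Fires, PTN.inFlow, PTN.outFlow]

theorem rateEntry_eq_sum {P T : Type} [DecidableEq P] (N : PTN P T)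
    (r : Multiset P → Multiset T → ℂ) (m m' : Multiset P)
    (h : {t : Multiset T | N.Fires m t m'}.Finite) :
    N.rateEntry r m m' = ∑ t ∈ h.toFinset, r m t :=
  finsum_mem_eq_finite_toFinset_sum _ h

/-- **Kronecker sum of QPNs.** Let `Q = (S, r)` and `Q' = (S', r')` be QPNs with
reachability sets `R₀`, `R₀'`. On the juxtaposition with initial marking `M₀·M₀'`,
define the rate function `r''` by `r''_{m·m'}(t·1) = r_m(t)` for nonempty `t`,
`r''_{m·m'}(1·t') = r'_{m'}(t')` for nonempty `t'`, `r''_{m·m'}(1) = r_m(1) + r'_{m'}(1)`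
for the empty concurrence, and `r''_{m·m'}(t·t') = 0` when both `t, t'` are nonempty.
Then, identifying the reachability set of the juxtaposition with `R₀ × R₀'`, the
resulting rate matrix equals the Kronecker sum `R_Q ⊗ I + I ⊗ R_{Q'}`. -/
theorem rateMatrix_kroneckerSum {P T P' T' : Type} [DecidableEq P] [DecidableEq P']
    (N : PTN P T) (N' : PTN P' T') (M0 : Multiset P) (M0' : Multiset P')
    (hfin : ∀ m m' : Multiset P, {t : Multiset T | N.Fires m t m'}.Finite)
    (hfin' : ∀ m m' : Multiset P', {t' : Multiset T' | N'.Fires m t' m'}.Finite)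
    (r : Multiset P → Multiset T → ℂ) (r' : Multiset P' → Multiset T' → ℂ)
    (r'' : Multiset (P ⊕ P') → Multiset (T ⊕ T') → ℂ)
    (hrLeft : ∀ (m : Multiset P) (m' : Multiset P') (t : Multiset T), t ≠ 0 →
      r'' (mprod m m') (mprod t (0 : Multiset T')) = r m t)
    (hrRight : ∀ (m : Multiset P) (m' : Multiset P') (t' : Multiset T'), t' ≠ 0 →
      r'' (mprod m m') (mprod (0 : Multiset T) t') = r' m' t')
    (hrUnit : ∀ (m : Multiset P) (m' : Multiset P'),
      r'' (mprod m m') (mprod (0 : Multiset T) (0 : Multiset T'))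
        = r m (0 : Multiset T) + r' m' (0 : Multiset T'))
    (hrZero : ∀ (m : Multiset P) (m' : Multiset P') (t : Multiset T) (t' : Multiset T'),
      t ≠ 0 → t' ≠ 0 → r'' (mprod m m') (mprod t t') = 0) :
    ∀ (m₁ m₂ : Multiset P) (m₁' m₂' : Multiset P'),
      m₁ ∈ N.ReachSet M0 → m₂ ∈ N.ReachSet M0 →
      m₁' ∈ N'.ReachSet M0' → m₂' ∈ N'.ReachSet M0' →
      (N.juxta N').rateEntry r'' (mprod m₁ m₁') (mprod m₂ m₂')
        = N.rateEntry r m₁ m₂ * (if m₂' = m₁' then 1 else 0)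
          + (if m₂ = m₁ then 1 else 0) * N'.rateEntry r' m₁' m₂' := by
  classical
  intro m₁ m₂ m₁' m₂' _ _ _ _
  have hrate (t : Multiset T) (t' : Multiset T') :
      r'' (mprod m₁ m₁') (mprod t t') =
        r m₁ t * (if t' = 0 then 1 else 0) + (if t = 0 then 1 else 0) * r' m₁' t' := by
    by_cases ht : t = 0 <;> by_cases ht' : t' = 0
    · subst ht ht'; simp [hrUnit]
    · subst ht; simp [hrRight _ _ _ ht', ht']
    · subst ht'; simp [hrLeft _ _ _ ht, ht]
    · simp [hrZero _ _ _ _ ht ht', ht, ht']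
  have hset : {u | (N.juxta N').Fires (mprod m₁ m₁') u (mprod m₂ m₂')} =
      Set.image (fun p : Multiset T × Multiset T' => mprod p.1 p.2)
        ↑((hfin m₁ m₂).toFinset ×ˢ (hfin' m₁' m₂').toFinset) := by
    ext u
    obtain ⟨t, t', rfl⟩ := exists_eq_mprod u
    simp [juxta_fires_mprod, mprod_inj]
  have hinj : Function.Injective fun p : Multiset T × Multiset T' => mprod p.1 p.2 :=
    fun p q h => Prod.ext_iff.mpr (mprod_inj.mp h)
  rw [PTN.rateEntry, hset, finsum_mem_image hinj.injOn, finsum_mem_coe_finset,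
    rateEntry_eq_sum N r _ _ (hfin m₁ m₂), rateEntry_eq_sum N' r' _ _ (hfin' m₁' m₂')]
  simp only [hrate, Finset.sum_add_distrib, Finset.sum_product]
  simp [fires_zero]
end
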